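/- Let H be a complex Hilbert space and let M be a von Neumann subalgebra of B(H) with inclusion map ℓ : M → B(H). Suppose there exists a bounded linear map p : B(H) → M with p ∘ ℓ = id_M, and suppose (M, ℓ) has the λ-Lindenstrauss–Pełczyński property for some λ ≥ 1. Then M has the Dunford–Pettis property. -/

import Mathlib

set_option synthInstance.maxHeartbeats 1000000
set_option maxHeartbeats 1000000

/-- `E` is an `L∞,λ`-space. -/
def IsLinftySpace (E : Type*) [NormedAddCommGroup E] [NormedSpace ℂ E] (lam : ℝ) : Prop :=
  (¬ FiniteDimensional ℂ E) ∧
  ∀ F : Subspace ℂ E, FiniteDimensional ℂ F →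
    ∃ G : Subspace ℂ E, F ≤ G ∧ FiniteDimensional ℂ G ∧
      ∃ T : G ≃L[ℂ] (Fin (Module.finrank ℂ G) → ℂ),
        ‖(T : G →L[ℂ] (Fin (Module.finrank ℂ G) → ℂ))‖ *
          ‖(T.symm : (Fin (Module.finrank ℂ G) → ℂ) →L[ℂ] G)‖ ≤ lam

/-- `(M, ℓ)` has the `λ`-Lindenstrauss–Pełczyński property. -/
def HasLPProperty {M Z : Type*} [NormedAddCommGroup M] [NormedSpace ℂ M]
    [NormedAddCommGroup Z] [NormedSpace ℂ Z] (lam : ℝ) (ℓ : M →L[ℂ] Z) : Prop :=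
  ∃ (E : Type) (_ : NormedAddCommGroup E) (_ : NormedSpace ℂ E),
    IsLinftySpace E lam ∧ ∃ (S : M →L[ℂ] E) (T : E →L[ℂ] Z), T.comp S = ℓ

/-- A complex Banach space `X` has the Dunford–Pettis property. -/
def HasDunfordPettis (X : Type*) [NormedAddCommGroup X] [NormedSpace ℂ X] : Prop :=
  ∀ (x : ℕ → X) (f : ℕ → (X →L[ℂ] ℂ)),
    (∀ g : X →L[ℂ] ℂ, Filter.Tendsto (fun n => g (x n)) Filter.atTop (nhds 0)) →
    (∀ Φ : (X →L[ℂ] ℂ) →L[ℂ] ℂ, Filter.Tendsto (fun n => Φ (f n)) Filter.atTop (nhds 0)) →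
    Filter.Tendsto (fun n => f n (x n)) Filter.atTop (nhds 0)

open Filter Topology MeasureTheory
open scoped NNReal ENNReal BoundedContinuousFunction

lemma dp_transfer {X Z : Type*} [NormedAddCommGroup X] [NormedSpace ℂ X]
    [NormedAddCommGroup Z] [NormedSpace ℂ Z] (hZ : HasDunfordPettis Z)
    (J : X →L[ℂ] Z) (R : (X →L[ℂ] ℂ) →L[ℂ] (Z →L[ℂ] ℂ))
    (h : ∀ f x, R f (J x) = f x) : HasDunfordPettis X := by
  intro x f hx hf
  have := hZ (fun n => J (x n)) (fun n => R (f n)) (fun g => hx (g.comp J))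
    (fun Φ => hf (Φ.comp R))
  simpa [h] using this

lemma ultra_bilin {ι X Y : Type*} [NormedAddCommGroup X] [NormedSpace ℂ X]
    [NormedAddCommGroup Y] [NormedSpace ℂ Y] (U : Ultrafilter ι)
    (b : ι → X →ₗ[ℂ] Y →ₗ[ℂ] ℂ) (C : ℝ) (hb : ∀ i x y, ‖b i x y‖ ≤ C * ‖x‖ * ‖y‖) :
    ∃ B : X →L[ℂ] Y →L[ℂ] ℂ, ∀ x y, Tendsto (fun i => b i x y) U (𝓝 (B x y)) := by
  have key : ∀ x y, ∃ z : ℂ, ‖z‖ ≤ C * ‖x‖ * ‖y‖ ∧ Tendsto (fun i => b i x y) U (𝓝 z) := by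
    intro x y
    have hc : IsCompact (Metric.closedBall (0:ℂ) (C * ‖x‖ * ‖y‖)) := isCompact_closedBall _ _
    obtain ⟨z, hz, hz2⟩ := hc.ultrafilter_le_nhds (U.map (fun i => b i x y)) (by
      rw [le_principal_iff]
      change ∀ᶠ i in (U : Filter ι), b i x y ∈ _
      refine Eventually.of_forall (fun i => ?_)
      simpa using hb i x y)
    exact ⟨z, by simpa using hz, hz2⟩
  choose B hB1 hB2 using key
  have U1 : ∀ {g : ι → ℂ} {a c : ℂ}, Tendsto g U (𝓝 a) → Tendsto g U (𝓝 c) → a = c :=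
    fun h1 h2 => tendsto_nhds_unique h1 h2
  let L : X →ₗ[ℂ] Y →ₗ[ℂ] ℂ := LinearMap.mk₂ ℂ B
    (fun x x' y => U1 (hB2 _ _) (by simpa using (hB2 x y).add (hB2 x' y)))
    (fun c x y => U1 (hB2 _ _) (by simpa using (hB2 x y).const_mul c))
    (fun x y y' => U1 (hB2 _ _) (by simpa using (hB2 x y).add (hB2 x y')))
    (fun c x y => U1 (hB2 _ _) (by simpa using (hB2 x y).const_mul c))
  refine ⟨L.mkContinuous₂ C (fun x y => hB1 x y), fun x y => hB2 x y⟩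

lemma glide {Z : Type*} [NormedAddCommGroup Z] [NormedSpace ℂ Z] (q : Z → ℝ)
    (q0 : q 0 = 0) (qadd : ∀ a b, q (a + b) ≤ q a + q b)
    (f : ℕ → (Z →L[ℂ] ℂ)) (C : ℕ → ℝ) (hC : ∀ n x, ‖f n x‖ ≤ C n * q x)
    (hf : ∀ Φ : (Z →L[ℂ] ℂ) →L[ℂ] ℂ, Tendsto (fun n => Φ (f n)) atTop (𝓝 0))
    (qneg : ∀ a, q (-a) = q a)
    (ε : ℝ) (hε : 0 < ε) :
    ∃ a : Z, ‖a‖ ≤ 1 ∧ ∃ r > 0, ∃ m : ℕ, ∀ n ≥ m, ∀ b : Z, ‖b‖ ≤ 1 → q (b - a) < r →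
      ‖f n b‖ ≤ ε := by
  by_contra! hcon
  let St := {s : Z × ℝ × ℕ // ‖s.1‖ ≤ 1 ∧ 0 < s.2.1}
  have step : ∀ s : St, ∃ t : St, s.1.2.2 < t.1.2.2 ∧
      (∀ b, q (b - t.1.1) ≤ t.1.2.1 → q (b - s.1.1) ≤ s.1.2.1) ∧
      (∀ b, q (b - t.1.1) ≤ t.1.2.1 → ε / 2 ≤ ‖f t.1.2.2 b‖) := by
    rintro ⟨⟨a, r, m⟩, ha, hr⟩
    simp only at ha hr
    obtain ⟨n, hn, b, hb, hq, hfb⟩ := hcon a ha (r/2) (by positivity) (m+1)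
    have hC' : 0 < |C n| + 1 := by positivity
    refine ⟨⟨⟨b, min (r/2) (ε / 2 / (|C n| + 1)), n⟩, hb, by positivity⟩, by simp; omega, ?_, ?_⟩
    · intro c hc
      simp only at hc ⊢
      have := qadd (c - b) (b - a)
      simp only [sub_add_sub_cancel] at this
      have := hc.trans (min_le_left _ _)
      linarith
    · intro c hc
      simp only at hc ⊢
      have h1 := hc.trans (min_le_right _ _)
      rw [le_div_iff₀ hC'] at h1
      have h2 := hC n (c - b)
      have h0 : 0 ≤ q (c - b) := by
        have := qadd (c - b) (-(c-b))
        rw [qneg] at this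
        simp [q0] at this
        linarith
      have h3 : C n * q (c - b) ≤ |C n| * q (c-b) := by gcongr; exact le_abs_self _
      have h4 : ‖f n b‖ ≤ ‖f n c‖ + ‖f n (c - b)‖ := by
        have : f n b = f n c - f n (c - b) := by simp
        rw [this]; exact norm_sub_le _ _
      nlinarith
  choose nx hnx1 hnx2 hnx3 using step
  let s0 : St := ⟨⟨0, 1, 0⟩, by simp, by simp⟩
  let s : ℕ → St := fun k => nx^[k] s0
  have hs : ∀ k, s (k+1) = nx (s k) := fun k => Function.iterate_succ_apply' _ _ _
  have nest : ∀ k j, ∀ b, q (b - (s (k+j)).1.1) ≤ (s (k+j)).1.2.1 →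
      q (b - (s k).1.1) ≤ (s k).1.2.1 := by
    intro k j
    induction j with
    | zero => intro b h; exact h
    | succ j ih =>
      intro b h
      rw [← add_assoc, hs] at h
      exact ih b (hnx2 _ _ h)
  have hbig : ∀ k j, k + 1 ≤ j → ε / 2 ≤ ‖f (s (k+1)).1.2.2 (s j).1.1‖ := by
    intro k j hkj
    obtain ⟨i, rfl⟩ := Nat.exists_eq_add_of_le hkj
    have h1 := nest (k+1) i (s (k+1+i)).1.1 (by simpa [q0] using (s (k+1+i)).2.2.le)
    rw [hs] at h1 ⊢
    exact hnx3 _ _ h1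
  have hn : ∀ k, k ≤ (s k).1.2.2 := by
    intro k
    induction k with
    | zero => simp
    | succ k ih => rw [hs]; have := hnx1 (s k); omega
  let U : Ultrafilter ℕ := Ultrafilter.of atTop
  have hU : (U : Filter ℕ) ≤ atTop := Ultrafilter.of_le atTop
  obtain ⟨B, hB⟩ := ultra_bilin (X := ℂ) (Y := Z →L[ℂ] ℂ) U
    (fun j => LinearMap.mk₂ ℂ (fun (c : ℂ) (g : Z →L[ℂ] ℂ) => c * g (s j).1.1)
      (by intros; simp [add_mul]) (by intros; simp [mul_assoc])
      (by intros; simp [mul_add]) (by intros; simp; ring)) 1 (by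
      intro i c g
      simp only [LinearMap.mk₂_apply, norm_mul, one_mul]
      gcongr
      exact (g.le_opNorm _).trans (mul_le_of_le_one_right (norm_nonneg _) (s i).2.1))
  have h1 := hf (B 1)
  have h2 : Tendsto (fun k => (s (k+1)).1.2.2) atTop atTop :=
    tendsto_atTop_mono (fun k => (Nat.le_succ k).trans (hn (k+1))) tendsto_id
  have h3 := (h1.comp h2).norm
  have h4 : ∀ k, ε / 2 ≤ ‖B 1 (f (s (k+1)).1.2.2)‖ := by
    intro k
    have := (hB 1 (f (s (k+1)).1.2.2)).norm
    refine ge_of_tendsto this ?_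
    refine Filter.Eventually.filter_mono hU ?_
    filter_upwards [eventually_ge_atTop (k+1)] with j hj
    simpa using hbig k j hj
  have h5 := ge_of_tendsto h3 (Eventually.of_forall h4)
  simp at h5
  linarith
section
variable {K : Type*} [TopologicalSpace K] [CompactSpace K]

noncomputable def dpV (f : C(K, ℂ) →L[ℂ] ℂ) (g : C(K, ℝ≥0)) : ℝ :=
  sSup {c : ℝ | ∃ y : C(K, ℂ), (∀ t, ‖y t‖ ≤ g t) ∧ c = ‖f y‖}

lemma dpV_bdd (f : C(K, ℂ) →L[ℂ] ℂ) (g : C(K, ℝ≥0)) :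
    BddAbove {c : ℝ | ∃ y : C(K, ℂ), (∀ t, ‖y t‖ ≤ g t) ∧ c = ‖f y‖} := by
  obtain ⟨C, hC⟩ := (isCompact_range g.continuous).bddAbove
  refine ⟨‖f‖ * C, ?_⟩
  rintro _ ⟨y, hy, rfl⟩
  refine (f.le_opNorm y).trans ?_
  gcongr
  rw [ContinuousMap.norm_le _ C.coe_nonneg]
  intro t
  exact (hy t).trans (by exact_mod_cast hC ⟨t, rfl⟩)

lemma le_dpV (f : C(K, ℂ) →L[ℂ] ℂ) (g : C(K, ℝ≥0)) (y : C(K, ℂ)) (hy : ∀ t, ‖y t‖ ≤ g t) :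
    ‖f y‖ ≤ dpV f g := le_csSup (dpV_bdd f g) ⟨y, hy, rfl⟩

lemma dpV_le (f : C(K, ℂ) →L[ℂ] ℂ) (g : C(K, ℝ≥0)) (c : ℝ)
    (h : ∀ y : C(K, ℂ), (∀ t, ‖y t‖ ≤ g t) → ‖f y‖ ≤ c) : dpV f g ≤ c := by
  refine csSup_le ⟨_, 0, by simp, rfl⟩ ?_
  rintro _ ⟨y, hy, rfl⟩
  exact h y hy

lemma dpV_nonneg (f : C(K, ℂ) →L[ℂ] ℂ) (g : C(K, ℝ≥0)) : 0 ≤ dpV f g :=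
  (norm_nonneg _).trans (le_dpV f g 0 (by simp))

lemma dpV_add (f : C(K, ℂ) →L[ℂ] ℂ) (g₁ g₂ : C(K, ℝ≥0)) :
    dpV f (g₁ + g₂) = dpV f g₁ + dpV f g₂ := by
  apply le_antisymm
  · refine dpV_le _ _ _ (fun y hy => ?_)
    refine le_of_forall_pos_le_add (fun δ hδ => ?_)
    set ε : ℝ := δ / (‖f‖ + 1) with hεdef
    have hf1 : 0 < ‖f‖ + 1 := by positivity
    have hε : 0 < ε := by positivity
    have hpos : ∀ t, 0 < (g₁ t : ℝ) + g₂ t + ε := fun t => by positivity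
    let w (g : C(K, ℝ≥0)) : C(K, ℂ) :=
      ⟨fun t => y t * (((g t : ℝ) / ((g₁ t : ℝ) + g₂ t + ε) : ℝ) : ℂ), by
        refine y.continuous.mul (Complex.continuous_ofReal.comp ?_)
        exact Continuous.div (by fun_prop) (by fun_prop) (fun t => (hpos t).ne')⟩
    have hw : ∀ g : C(K, ℝ≥0), ∀ t, ‖w g t‖ ≤ g t := by
      intro g t
      simp only [w, ContinuousMap.coe_mk, norm_mul, Complex.norm_real, Real.norm_eq_abs]
      rw [abs_of_nonneg (div_nonneg (g t).coe_nonneg (hpos t).le), mul_div_assoc', div_le_iff₀ (hpos t),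
        mul_comm]
      have h1 := hy t
      simp only [ContinuousMap.add_apply, NNReal.coe_add] at h1
      gcongr
      linarith
    have hr : ‖y - w g₁ - w g₂‖ ≤ ε := by
      rw [ContinuousMap.norm_le _ hε.le]
      intro t
      have e : (y - w g₁ - w g₂) t = y t * ((ε / ((g₁ t : ℝ) + g₂ t + ε) : ℝ) : ℂ) := by
        simp only [w, ContinuousMap.sub_apply, ContinuousMap.coe_mk]
        have e1 : ε / ((g₁ t : ℝ) + g₂ t + ε) = 1 - (g₁ t : ℝ) / ((g₁ t : ℝ) + g₂ t + ε)
            - (g₂ t : ℝ) / ((g₁ t : ℝ) + g₂ t + ε) := by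
          have := (hpos t).ne'
          field_simp
          ring
        rw [e1]
        simp only [Complex.ofReal_sub, Complex.ofReal_one]
        ring
      rw [e, norm_mul, Complex.norm_real, Real.norm_eq_abs,
        abs_of_nonneg (div_nonneg hε.le (hpos t).le), mul_div_assoc', div_le_iff₀ (hpos t), mul_comm]
      have h1 := hy t
      simp only [ContinuousMap.add_apply, NNReal.coe_add] at h1
      gcongr
      linarith
    have h1 := le_dpV f g₁ _ (hw g₁)
    have h2 := le_dpV f g₂ _ (hw g₂)
    have h3 : ‖f (y - w g₁ - w g₂)‖ ≤ δ := by
      refine (f.le_opNorm _).trans ?_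
      calc ‖f‖ * ‖y - w g₁ - w g₂‖ ≤ (‖f‖ + 1) * ε := by gcongr; linarith
        _ = δ := by rw [hεdef]; field_simp
    have e : f y = f (w g₁) + f (w g₂) + f (y - w g₁ - w g₂) := by simp
    rw [e]
    exact (norm_add₃_le).trans (by linarith)
  · suffices h : dpV f g₁ ≤ dpV f (g₁ + g₂) - dpV f g₂ by linarith
    refine dpV_le _ _ _ (fun y₁ h₁ => ?_)
    suffices h : dpV f g₂ ≤ dpV f (g₁ + g₂) - ‖f y₁‖ by linarith
    refine dpV_le _ _ _ (fun y₂ h₂ => ?_)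
    obtain ⟨c₁, hc₁, e₁⟩ := RCLike.exists_norm_eq_mul_self (f y₁)
    obtain ⟨c₂, hc₂, e₂⟩ := RCLike.exists_norm_eq_mul_self (f y₂)
    have := le_dpV f (g₁ + g₂) (c₁ • y₁ + c₂ • y₂) (fun t => by
      refine (norm_add_le _ _).trans ?_
      simp only [ContinuousMap.smul_apply, norm_smul, hc₁, hc₂, one_mul,
        ContinuousMap.add_apply, NNReal.coe_add]
      exact add_le_add (h₁ t) (h₂ t))
    have e : f (c₁ • y₁ + c₂ • y₂) = ((‖f y₁‖ + ‖f y₂‖ : ℝ) : ℂ) := by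
      simp only [map_add, map_smul, smul_eq_mul]
      rw [← e₁, ← e₂]; simp
    rw [e, Complex.norm_real, Real.norm_eq_abs, abs_of_nonneg (by positivity)] at this
    linarith

lemma dpV_smul_le (f : C(K, ℂ) →L[ℂ] ℂ) (c : ℝ≥0) (hc : c ≠ 0) (g : C(K, ℝ≥0)) :
    dpV f (c • g) ≤ c * dpV f g := by
  refine dpV_le _ _ _ (fun y hy => ?_)
  have hc' : (0:ℝ) < c := by positivity
  have := le_dpV f g (((c⁻¹ : ℝ≥0) : ℂ) • y) (fun t => by
    have := hy t
    simp only [ContinuousMap.smul_apply, smul_eq_mul, NNReal.coe_mul] at this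
    simp only [ContinuousMap.smul_apply, norm_smul]
    simp
    rw [inv_mul_le_iff₀ hc']
    exact this)
  rw [map_smul, norm_smul] at this
  simp at this
  rwa [inv_mul_le_iff₀ hc'] at this

lemma dpV_smul (f : C(K, ℂ) →L[ℂ] ℂ) (c : ℝ≥0) (g : C(K, ℝ≥0)) :
    dpV f (c • g) = c * dpV f g := by
  rcases eq_or_ne c 0 with rfl | hc
  · have := dpV_add f 0 0
    simp at this
    simp [this]
  · apply le_antisymm (dpV_smul_le f c hc g)
    have := dpV_smul_le f c⁻¹ (inv_ne_zero hc) (c • g)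
    rw [smul_smul, inv_mul_cancel₀ hc, one_smul] at this
    have hc' : (0:ℝ) < c := by positivity
    rw [NNReal.coe_inv] at this
    rwa [le_inv_mul_iff₀ hc'] at this

open CompactlySupported in
lemma dom_measure [T2Space K] [MeasurableSpace K] [BorelSpace K] (f : C(K, ℂ) →L[ℂ] ℂ) :
    ∃ μ : Measure K, IsFiniteMeasure μ ∧ ∀ x : C(K, ℂ), ‖f x‖ ≤ ∫ t, ‖x t‖ ∂μ := by
  let Λ : C_c(K, ℝ≥0) →ₗ[ℝ≥0] ℝ≥0 :=
    { toFun := fun g => ⟨dpV f g.toContinuousMap, dpV_nonneg _ _⟩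
      map_add' := fun a b => NNReal.eq (dpV_add f _ _)
      map_smul' := fun c a => NNReal.eq (dpV_smul f c _) }
  refine ⟨NNRealRMK.rieszMeasure Λ, inferInstance, fun x => ?_⟩
  let g : C_c(K, ℝ≥0) := ⟨⟨fun t => ‖x t‖₊, by fun_prop⟩, HasCompactSupport.of_compactSpace _⟩
  have := NNRealRMK.integral_rieszMeasure Λ g
  have e : ∫ t, ‖x t‖ ∂(NNRealRMK.rieszMeasure Λ) = dpV f g.toContinuousMap := this
  rw [e]
  exact le_dpV f _ x (fun t => le_rfl)

lemma dom_measure_seq [T2Space K] [MeasurableSpace K] [BorelSpace K]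
    (f : ℕ → (C(K, ℂ) →L[ℂ] ℂ)) :
    ∃ μ : Measure K, IsFiniteMeasure μ ∧ ∃ C : ℕ → ℝ,
      ∀ n, ∀ x : C(K, ℂ), ‖f n x‖ ≤ C n * ∫ t, ‖x t‖ ∂μ := by
  choose ν hν1 hν2 using fun n => dom_measure (f n)
  let c : ℕ → ℝ≥0∞ := fun n => (2⁻¹ : ℝ≥0∞) ^ n * (ν n Set.univ + 1)⁻¹
  have hc0 : ∀ n, c n ≠ 0 := fun n => by simp [c, measure_ne_top]
  have hct : ∀ n, c n ≠ ⊤ := fun n => by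
    refine ENNReal.mul_ne_top (by simp) (by simp)
  have hfin : IsFiniteMeasure (Measure.sum (fun n => c n • ν n)) := by
    constructor
    rw [Measure.sum_apply _ MeasurableSet.univ]
    refine lt_of_le_of_lt (ENNReal.tsum_le_tsum (g := fun n => (2⁻¹ : ℝ≥0∞) ^ n) (fun n => ?_)) ?_
    · simp only [Measure.smul_apply, smul_eq_mul, c, mul_assoc]
      refine mul_le_of_le_one_right' ?_
      rw [mul_comm, ← div_eq_mul_inv]
      refine ENNReal.div_le_of_le_mul ?_
      simp
    · rw [ENNReal.tsum_geometric]
      simp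
  refine ⟨_, hfin, fun n => (c n).toReal⁻¹, fun n x => (hν2 n x).trans ?_⟩
  have hpos : 0 < (c n).toReal := ENNReal.toReal_pos (hc0 n) (hct n)
  rw [le_inv_mul_iff₀ hpos, ← smul_eq_mul, ← integral_smul_measure]
  refine integral_mono_measure (Measure.le_sum (fun n => c n • ν n) n)
    (Eventually.of_forall fun t => norm_nonneg _) ?_
  exact BoundedContinuousFunction.integrable _ (BoundedContinuousFunction.mkOfCompact
    (⟨fun t => ‖x t‖, by fun_prop⟩ : C(K, ℝ)))
end
lemma dp_bounded {X : Type*} [NormedAddCommGroup X] [NormedSpace ℂ X] (x : ℕ → X)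
    (hx : ∀ g : X →L[ℂ] ℂ, Tendsto (fun n => g (x n)) atTop (𝓝 0)) :
    ∃ D : ℝ, 0 < D ∧ ∀ n, ‖x n‖ ≤ D := by
  obtain ⟨C, hC⟩ := banach_steinhaus
    (g := fun n => NormedSpace.inclusionInDoubleDualLi ℂ (E := X) (x n)) (by
      intro g
      obtain ⟨C, hC⟩ := (hx g).norm.bddAbove_range
      exact ⟨C, fun n => hC ⟨n, rfl⟩⟩)
  refine ⟨|C| + 1, by positivity, fun n => ?_⟩
  have := hC n
  rw [LinearIsometry.norm_map] at this
  linarith [le_abs_self C]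

lemma dp_CK (K : Type*) [TopologicalSpace K] [CompactSpace K] [T2Space K] :
    HasDunfordPettis C(K, ℂ) := by
  intro x f hx hf
  letI : MeasurableSpace K := borel K
  haveI : BorelSpace K := ⟨rfl⟩
  obtain ⟨D, hD, hxD⟩ := dp_bounded x hx
  obtain ⟨μ, hμ, C, hC⟩ := dom_measure_seq f
  let q : C(K, ℂ) → ℝ := fun x => ∫ t, ‖x t‖ ∂μ
  have hint : ∀ y : C(K, ℂ), Integrable (fun t => ‖y t‖) μ := fun y =>
    BoundedContinuousFunction.integrable _ (BoundedContinuousFunction.mkOfCompact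
      (⟨fun t => ‖y t‖, by fun_prop⟩ : C(K, ℝ)))
  have qmono : ∀ y z : C(K, ℂ), (∀ t, ‖y t‖ ≤ ‖z t‖) → q y ≤ q z := fun y z h =>
    integral_mono (hint y) (hint z) h
  have q0 : q 0 = 0 := by simp [q]
  have qadd : ∀ a b, q (a + b) ≤ q a + q b := by
    intro a b
    simp only [q]
    rw [← integral_add (hint a) (hint b)]
    exact integral_mono (hint (a + b)) ((hint a).add (hint b)) (fun t => norm_add_le _ _)
  have qneg : ∀ a, q (-a) = q a := by intro a; simp [q]
  let x' : ℕ → C(K, ℂ) := fun n => ((D⁻¹ : ℝ) : ℂ) • x n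
  have hx' : ∀ n, ‖x' n‖ ≤ 1 := by
    intro n
    simp only [x', norm_smul, Complex.norm_real, Real.norm_eq_abs, abs_inv, abs_of_pos hD]
    rw [inv_mul_le_iff₀ hD]; simpa using hxD n
  have hq : Tendsto (fun n => q (x' n)) atTop (𝓝 0) := by
    have := tendsto_integral_of_dominated_convergence (μ := μ) (F := fun n t => ‖x' n t‖)
      (f := fun _ => (0:ℝ)) (fun _ => (1:ℝ)) (fun n => (hint (x' n)).aestronglyMeasurable)
      (integrable_const _)
      (fun n => Eventually.of_forall fun t => by
        simpa using ((x' n).norm_coe_le_norm t).trans (hx' n))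
      (Eventually.of_forall fun t => by
        have h := (hx (ContinuousMap.evalCLM ℂ t)).const_smul ((D⁻¹ : ℝ) : ℂ)
        simpa [x'] using h.norm)
    simpa [q] using this
  suffices h : Tendsto (fun n => f n (x' n)) atTop (𝓝 0) by
    have h2 := h.const_mul (D : ℂ)
    have hD' : (D : ℂ) ≠ 0 := by exact_mod_cast hD.ne'
    simpa [x', hD'] using h2
  rw [Metric.tendsto_atTop]
  intro ε hε
  obtain ⟨a, ha, r, hr, m, hm⟩ := glide q q0 qadd f C hC hf qneg (ε / 3) (by positivity)
  have ev : ∀ᶠ n in atTop, q (x' n) < r / 2 := hq.eventually_lt_const (by positivity)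
  obtain ⟨m', hm'⟩ := eventually_atTop.1 ev
  refine ⟨max m m', fun n hn => ?_⟩
  have hn1 : m ≤ n := (le_max_left _ _).trans hn
  have hqn := hm' n ((le_max_right _ _).trans hn)
  have hxt : ∀ t, ‖x' n t‖ ≤ 1 := fun t => ((x' n).norm_coe_le_norm t).trans (hx' n)
  have hat : ∀ t, ‖a t‖ ≤ 1 := fun t => (a.norm_coe_le_norm t).trans ha
  let w : C(K, ℂ) := ⟨fun t => a t * ((‖x' n t‖ : ℝ) : ℂ), by fun_prop⟩
  have hw : ∀ t, ‖w t‖ ≤ ‖x' n t‖ := by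
    intro t
    simp only [w, ContinuousMap.coe_mk, norm_mul, Complex.norm_real, norm_norm]
    exact mul_le_of_le_one_left (norm_nonneg _) (hat t)
  have haw : ∀ t, ‖(a - w) t‖ ≤ 1 - ‖x' n t‖ := by
    intro t
    have e : (a - w) t = a t * ((1 - ‖x' n t‖ : ℝ) : ℂ) := by simp [w]; ring
    have h1 : 0 ≤ 1 - ‖x' n t‖ := by linarith [hxt t]
    rw [e, norm_mul, Complex.norm_real, Real.norm_eq_abs, abs_of_nonneg h1]
    exact mul_le_of_le_one_left h1 (hat t)
  have hqw := qmono w (x' n) hw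
  have hq0 : 0 ≤ q (x' n) := integral_nonneg fun t => norm_nonneg _
  have hc := hm n hn1 (a - w) (by
      rw [ContinuousMap.norm_le _ zero_le_one]
      intro t; linarith [haw t, norm_nonneg (x' n t)]) (by
      rw [show a - w - a = -w by abel, qneg]; linarith)
  have hb := hm n hn1 (a - w + x' n) (by
      rw [ContinuousMap.norm_le _ zero_le_one]
      intro t
      refine (norm_add_le _ _).trans ?_
      linarith [haw t]) (by
      rw [show a - w + x' n - a = -w + x' n by abel]
      have := qadd (-w) (x' n)
      rw [qneg] at this; linarith)
  have e : f n (x' n) = f n (a - w + x' n) - f n (a - w) := by simp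
  rw [dist_zero_right, e]
  exact lt_of_le_of_lt (norm_sub_le _ _) (by linarith)

lemma dp_cstar (A : Type*) [CommCStarAlgebra A] : HasDunfordPettis A := by
  let e := gelfandStarTransform A
  have he : ∀ a, ‖e a‖ = ‖a‖ := fun a =>
    (gelfandTransform_isometry A).norm_map_of_map_zero (map_zero _) a
  let e' : A ≃ₗᵢ[ℂ] C(WeakDual.characterSpace ℂ A, ℂ) :=
    { toLinearEquiv := e.toAlgEquiv.toLinearEquiv
      norm_map' := he }
  refine dp_transfer (dp_CK (WeakDual.characterSpace ℂ A))
    (e'.toContinuousLinearEquiv : A →L[ℂ] C(WeakDual.characterSpace ℂ A, ℂ))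
    (ContinuousLinearMap.precomp ℂ
      (e'.symm.toContinuousLinearEquiv : C(WeakDual.characterSpace ℂ A, ℂ) →L[ℂ] A)) ?_
  intro f x
  simp

lemma dp_linfty {E : Type*} [NormedAddCommGroup E] [NormedSpace ℂ E] (lam : ℝ)
    (hlam : 0 ≤ lam) (hE : IsLinftySpace E lam) : HasDunfordPettis E := by
  have h := hE.2
  choose G hFG hGfin T hT using
    fun s : Finset E => h (Submodule.span ℂ (s : Set E)) (FiniteDimensional.span_finset ℂ s)
  let n : Finset E → ℕ := fun s => Module.finrank ℂ (G s)
  let c : Finset E → ℝ := fun s =>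
    ‖((T s).symm : (Fin (Module.finrank ℂ (G s)) → ℂ) →L[ℂ] G s)‖
  have hc : ∀ s, 0 ≤ c s := fun s => ContinuousLinearMap.opNorm_nonneg _
  have hext : ∀ s (i : Fin (n s)), ∃ g : E →L[ℂ] ℂ,
      (∀ x : G s, g x = (c s : ℂ) * T s x i) ∧ ‖g‖ ≤ lam := by
    intro s i
    let φ : G s →L[ℂ] ℂ := (c s : ℂ) • ((ContinuousLinearMap.proj i).comp
      (T s : G s →L[ℂ] (Fin (Module.finrank ℂ (G s)) → ℂ)))
    obtain ⟨g, hg, hgn⟩ := exists_extension_norm_eq (G s) φ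
    refine ⟨g, fun x => by rw [hg]; rfl, ?_⟩
    rw [hgn]
    refine ContinuousLinearMap.opNorm_le_bound _ hlam (fun x => ?_)
    have h1 : ‖T s x i‖ ≤ ‖(T s : G s →L[ℂ] (Fin (Module.finrank ℂ (G s)) → ℂ))‖ * ‖x‖ :=
      (norm_le_pi_norm (T s x) i).trans
        ((T s : G s →L[ℂ] (Fin (Module.finrank ℂ (G s)) → ℂ)).le_opNorm x)
    have h2 : ‖φ x‖ = c s * ‖T s x i‖ := by
      change ‖(c s : ℂ) * T s x i‖ = _
      rw [norm_mul, Complex.norm_real, Real.norm_eq_abs, abs_of_nonneg (hc s)]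
    rw [h2]
    calc c s * ‖T s x i‖
        ≤ c s * (‖(T s : G s →L[ℂ] (Fin (Module.finrank ℂ (G s)) → ℂ))‖ * ‖x‖) :=
          mul_le_mul_of_nonneg_left h1 (hc s)
      _ = (‖(T s : G s →L[ℂ] (Fin (Module.finrank ℂ (G s)) → ℂ))‖ * c s) * ‖x‖ := by ring
      _ ≤ lam * ‖x‖ := mul_le_mul_of_nonneg_right (hT s) (norm_nonneg _)
  choose t ht htn using hext
  let I := Σ s : Finset E, Fin (n s)
  letI : TopologicalSpace I := ⊥
  haveI : DiscreteTopology I := ⟨rfl⟩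
  have htb : ∀ x (i : I), ‖t i.1 i.2 x‖ ≤ lam * ‖x‖ := fun x i =>
    ((t i.1 i.2).le_opNorm x).trans (mul_le_mul_of_nonneg_right (htn _ _) (norm_nonneg _))
  let J₀ : E →ₗ[ℂ] (I →ᵇ ℂ) :=
    { toFun := fun x => BoundedContinuousFunction.ofNormedAddCommGroupDiscrete
        (fun i : I => t i.1 i.2 x) (lam * ‖x‖) (htb x)
      map_add' := fun x y => by ext i; simp
      map_smul' := fun a x => by ext i; simp }
  let J : E →L[ℂ] (I →ᵇ ℂ) := J₀.mkContinuous lam (fun x => by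
    rw [BoundedContinuousFunction.norm_le (by positivity)]
    exact htb x)
  let W : ∀ s, (I →ᵇ ℂ) →ₗ[ℂ] E := fun s =>
    ((c s : ℂ)⁻¹) • ((G s).subtype ∘ₗ (T s).symm.toLinearEquiv.toLinearMap ∘ₗ
      { toFun := fun v i => v ⟨s, i⟩
        map_add' := fun v w => by ext i; simp
        map_smul' := fun a v => by ext i; simp })
  have hWdef : ∀ s v, W s v = ((c s : ℂ)⁻¹) • (((T s).symm (fun i => v ⟨s, i⟩) : G s) : E) :=
    fun s v => rfl
  have hW : ∀ s v, ‖W s v‖ ≤ ‖v‖ := by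
    intro s v
    rw [hWdef, norm_smul, norm_inv, Complex.norm_real, Real.norm_eq_abs, abs_of_nonneg (hc s)]
    have h1 : ‖(fun i => v ⟨s, i⟩ : Fin (n s) → ℂ)‖ ≤ ‖v‖ := by
      rw [pi_norm_le_iff_of_nonneg (norm_nonneg _)]
      exact fun i => v.norm_coe_le_norm _
    have h2 : ‖(((T s).symm (fun i => v ⟨s, i⟩) : G s) : E)‖ ≤ c s * ‖v‖ :=
      (((T s).symm : (Fin (Module.finrank ℂ (G s)) → ℂ) →L[ℂ] G s).le_opNorm _).trans
        (mul_le_mul_of_nonneg_left h1 (hc s))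
    rcases (hc s).eq_or_lt with h0 | h0
    · rw [← h0]; simp
    · rw [inv_mul_le_iff₀ h0]; exact h2
  have hWJ : ∀ s x, x ∈ G s → W s (J x) = x := by
    intro s x hx
    rw [hWdef]
    have e : (fun i => J x ⟨s, i⟩ : Fin (n s) → ℂ) = (c s : ℂ) • T s ⟨x, hx⟩ := by
      ext i
      exact ht s i ⟨x, hx⟩
    rw [e, map_smul, ContinuousLinearEquiv.symm_apply_apply]
    rcases (hc s).eq_or_lt with h0 | h0
    · have : ‖(⟨x, hx⟩ : G s)‖ ≤ c s * ‖T s ⟨x, hx⟩‖ := by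
        have := ((T s).symm : (Fin (Module.finrank ℂ (G s)) → ℂ) →L[ℂ] G s).le_opNorm
          (T s ⟨x, hx⟩)
        simpa using this
      rw [← h0, zero_mul] at this
      have hx0 : x = 0 := by simpa using this
      simp [hx0]
    · have : (c s : ℂ) ≠ 0 := by exact_mod_cast h0.ne'
      rw [Submodule.coe_smul, smul_smul, inv_mul_cancel₀ this, one_smul]
  let U : Ultrafilter (Finset E) := Ultrafilter.of atTop
  have hU : (U : Filter (Finset E)) ≤ atTop := Ultrafilter.of_le atTop
  obtain ⟨R, hR⟩ := ultra_bilin (X := E →L[ℂ] ℂ) (Y := I →ᵇ ℂ) U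
    (fun s => LinearMap.mk₂ ℂ (fun f v => f (W s v))
      (by intros; simp) (by intros; simp) (by intros; simp) (by intros; simp)) 1 (by
      intro s f v
      simp only [LinearMap.mk₂_apply, one_mul]
      exact (f.le_opNorm _).trans (mul_le_mul_of_nonneg_left (hW s v) (norm_nonneg _)))
  refine dp_transfer (dp_cstar (I →ᵇ ℂ)) J R ?_
  intro f x
  refine tendsto_nhds_unique (hR f (J x)) ?_
  refine Tendsto.congr' (f₁ := fun _ => f x) ?_ tendsto_const_nhds
  refine Filter.Eventually.filter_mono hU ?_
  filter_upwards [eventually_ge_atTop {x}] with s hs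
  simp only [LinearMap.mk₂_apply]
  rw [hWJ s x (hFG s (Submodule.subset_span (hs (by simp))))]

theorem stmt_6 {H : Type} [NormedAddCommGroup H] [InnerProductSpace ℂ H] [CompleteSpace H]
    (M : VonNeumannAlgebra H)
    (ℓ : M.toSubalgebra →L[ℂ] (H →L[ℂ] H))
    (hℓ : ∀ x : M.toSubalgebra, ℓ x = (x : H →L[ℂ] H))
    (p : (H →L[ℂ] H) →L[ℂ] M.toSubalgebra)
    (hp : p.comp ℓ = ContinuousLinearMap.id ℂ M.toSubalgebra)
    (lam : ℝ) (hlam : 1 ≤ lam) (h : HasLPProperty lam ℓ) :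
    HasDunfordPettis M.toSubalgebra := by

  obtain ⟨E, i1, i2, hE, S, T, hTS⟩ := h
  refine dp_transfer (dp_linfty lam (by linarith) hE) S
    (ContinuousLinearMap.precomp ℂ (p.comp T)) ?_
  intro f x
  have h1 : T (S x) = ℓ x := congrArg (fun g => g x) hTS
  have h2 : p (ℓ x) = x := congrArg (fun g => g x) hp
  simp [h1, h2]
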